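/- Let G be a group and S a subset of G such that some product w = s₁ s₂ ⋯ s_k of elements of S (with each s ∈ S appearing at least once) satisfies wᴺ = 1 for some N ≥ 1. Then the submonoid of G generated by S is a subgroup of G. -/

import Mathlib

/-- If every generator has its inverse in the submonoid generated by `S`, then that submonoid is
closed under inversion. -/
theorem Submonoid.inv_mem_closure_of_forall_inv_mem {G : Type*} [Group G] {S : Set G}
    (h : ∀ s ∈ S, s⁻¹ ∈ Submonoid.closure S) {x : G} (hx : x ∈ Submonoid.closure S) :
    x⁻¹ ∈ Submonoid.closure S := by
  induction hx using Submonoid.closure_induction with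
  | mem s hs => exact h s hs
  | one => simp
  | mul a b _ _ ha hb => simpa using mul_mem hb ha

/-- If a product of elements of a submonoid of a group is torsion, then the submonoid contains
the inverse of each factor. -/
theorem Submonoid.inv_mem_of_mem_of_list_prod_pow_eq_one {G : Type*} [Group G] (M : Submonoid G)
    {l : List G} (hl : ∀ x ∈ l, x ∈ M) {N : ℕ} (hN : N ≠ 0) (hw : l.prod ^ N = 1)
    {s : G} (hs : s ∈ l) : s⁻¹ ∈ M := by
  obtain ⟨n, rfl⟩ := Nat.exists_eq_succ_of_ne_zero hN
  have hpow : l.prod ^ n ∈ M := pow_mem (M.list_prod_mem hl) n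
  obtain ⟨a, b, rfl⟩ := List.append_of_mem hs
  have ha : a.prod ∈ M := M.list_prod_mem fun x hx => hl x (by simp [hx])
  have hb : b.prod ∈ M := M.list_prod_mem fun x hx => hl x (by simp [hx])
  generalize hp : (a ++ s :: b).prod ^ n = p at hpow
  rw [Nat.succ_eq_add_one, pow_succ', hp, List.prod_append, List.prod_cons] at hw
  have hinv : s⁻¹ = b.prod * p * a.prod := by
    rw [inv_eq_iff_mul_eq_one]
    have h : a.prod * (s * b.prod * p) = 1 := by simpa only [mul_assoc] using hw
    simpa only [mul_assoc] using mul_eq_one_comm.mp h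
  rw [hinv]
  exact mul_mem (mul_mem hb hpow) ha

/-- If some product of elements of `S`, in which every element of `S` appears at least
once, is torsion (`w^N = 1`, `N ≥ 1`), then the submonoid of `G` generated by `S`
is actually a subgroup of `G`. -/
theorem submonoid_closure_is_subgroup_of_relator {G : Type*} [Group G] (S : Set G)
    (l : List G) (hl : ∀ x ∈ l, x ∈ S) (hall : ∀ s ∈ S, s ∈ l)
    (N : ℕ) (hN : 1 ≤ N) (hw : l.prod ^ N = 1) :
    ∃ H : Subgroup G, (H : Set G) = (Submonoid.closure S : Set G) := by
  have hinv : ∀ s ∈ S, s⁻¹ ∈ Submonoid.closure S := fun s hs =>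
    (Submonoid.closure S).inv_mem_of_mem_of_list_prod_pow_eq_one
      (fun x hx => Submonoid.subset_closure (hl x hx)) (Nat.one_le_iff_ne_zero.mp hN) hw (hall s hs)
  exact ⟨{ Submonoid.closure S with
    inv_mem' := Submonoid.inv_mem_closure_of_forall_inv_mem hinv }, rfl⟩
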